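/- Suppose (θ₀,…,θ₆) ∈ (T³)⁷ is such that among the seven first coordinates θ₀¹,…,θ₆¹ there are exactly 3 distinct values, occurring with multiplicities 3, 2, 2. Then |Θ(θ₀,…,θ₆)| ≤ 8/35. -/

import Mathlib

open scoped BigOperators
open scoped Classical

noncomputable section

instance : Fact ((0:ℝ) < 1) := ⟨one_pos⟩

/-- The circle `ℝ/ℤ` with its standard circular order. -/
abbrev S1 : Type := AddCircle (1 : ℝ)

/-- The 3-torus `S¹ × S¹ × S¹`. -/
abbrev T3 : Type := S1 × S1 × S1

/-- The orientation cocycle on the circle: `1` if `(a,b,c)` are pairwise distinct and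
positively oriented, `-1` if pairwise distinct and negatively oriented, `0` otherwise. -/
noncomputable def OrS1 (a b c : S1) : ℝ :=
  if sbtw a b c then 1 else if sbtw c b a then -1 else 0

/-- The cocycle `Θ` on `(T³)⁷`. -/
noncomputable def Theta (θ : Fin 7 → T3) : ℝ :=
  (1 / (Nat.factorial 7 : ℝ)) * ∑ σ : Equiv.Perm (Fin 7),
    ((Equiv.Perm.sign σ : ℤ) : ℝ) *
      (OrS1 (θ (σ 0)).1 (θ (σ 1)).1 (θ (σ 2)).1 *
       OrS1 (θ (σ 2)).2.1 (θ (σ 3)).2.1 (θ (σ 4)).2.1 *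
       OrS1 (θ (σ 4)).2.2 (θ (σ 5)).2.2 (θ (σ 6)).2.2)

theorem OrS1_rotate (a b c : S1) : OrS1 b c a = OrS1 a b c := by
  unfold OrS1
  have h1 : sbtw b c a ↔ sbtw a b c := sbtw_cyclic
  have h2 : sbtw a c b ↔ sbtw c b a := sbtw_cyclic.symm
  simp only [h1, h2]

theorem OrS1_reverse (a b c : S1) : OrS1 c b a = -OrS1 a b c := by
  unfold OrS1
  have h : sbtw a b c → ¬ sbtw c b a := fun h => h.not_sbtw
  split_ifs <;> simp_all

theorem OrS1_cases (a b c : S1) : OrS1 a b c = 1 ∨ OrS1 a b c = -1 ∨ OrS1 a b c = 0 := by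
  unfold OrS1
  split_ifs <;> simp

theorem abs_OrS1_le_one (a b c : S1) : |OrS1 a b c| ≤ 1 := by
  rcases OrS1_cases a b c with h | h | h <;> simp [h]

theorem OrS1_self_left (a b : S1) : OrS1 a a b = 0 := by
  linarith [OrS1_reverse a a b, OrS1_rotate a a b, OrS1_rotate a b a]

theorem sbtw_or_sbtw {a b c : S1} (hab : a ≠ b) (hbc : b ≠ c) (hca : c ≠ a) :
    sbtw a b c ∨ sbtw c b a := by
  by_contra! h
  rcases (btw_iff_not_sbtw.2 h.2).antisymm (btw_iff_not_sbtw.2 h.1) with h | h | h <;> contradiction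

theorem OrS1_self_right (a b : S1) : OrS1 a b b = 0 := by
  rw [← OrS1_rotate a b b, OrS1_self_left]

theorem OrS1_self_outer (a b : S1) : OrS1 a b a = 0 := by
  rw [OrS1_rotate a a b, OrS1_self_left]

theorem OrS1_cocycle (a b c d : S1) :
    OrS1 b c d - OrS1 a c d + OrS1 a b d - OrS1 a b c = 0 := by
  by_cases hab : a = b
  · subst hab; simp [OrS1_self_left]
  by_cases hbc : b = c
  · subst hbc; simp [OrS1_self_left, OrS1_self_right]
  by_cases hcd : c = d
  · subst hcd; simp [OrS1_self_right]
  by_cases hda : d = a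
  · subst hda; simp [OrS1_self_outer, OrS1_rotate]
  by_cases hac : a = c
  · subst hac; simp only [OrS1_self_left, OrS1_self_outer]
    linarith [OrS1_reverse a b d, OrS1_rotate d b a]
  by_cases hbd : b = d
  · subst hbd; simp only [OrS1_self_right, OrS1_self_outer]
    linarith [OrS1_reverse a b c, OrS1_rotate a c b]
  have trans_left (x y z w : S1) : sbtw x y z → sbtw y w z → sbtw x w z := sbtw_trans_left
  have cyc (x y z : S1) : sbtw x y z → sbtw y z x := sbtw_cyclic_left
  have asymm (x y z : S1) : sbtw x y z → ¬ sbtw z y x := sbtw_asymm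
  have h1 := sbtw_or_sbtw hbc hcd (Ne.symm hbd)
  have h2 := sbtw_or_sbtw hac hcd hda
  have h3 := sbtw_or_sbtw hab hbd hda
  have h4 := sbtw_or_sbtw hab hbc (Ne.symm hac)
  unfold OrS1
  rcases h1 with h1 | h1 <;> rcases h2 with h2 | h2 <;> rcases h3 with h3 | h3 <;>
    rcases h4 with h4 | h4 <;>
    simp [h1, h2, h3, h4, asymm _ _ _ h1, asymm _ _ _ h2, asymm _ _ _ h3, asymm _ _ _ h4] <;>
    grind

/-- The sum over the six edges of a tetrahedron of the absolute value of the sum of its two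
faces containing the opposite edge. -/
theorem sum_abs_OrS1_add_le (w x y z : S1) :
    |OrS1 x y z + OrS1 w y z| + |OrS1 y x z + OrS1 w x z| + |OrS1 z y x + OrS1 w y x| +
    |OrS1 x w z + OrS1 y w z| + |OrS1 x y w + OrS1 z y w| + |OrS1 z w x + OrS1 y w x| ≤ 8 := by
  have hc := OrS1_cocycle w x y z
  rw [OrS1_reverse x y z, OrS1_reverse w y z, OrS1_reverse x y w,
    show OrS1 y x z = -OrS1 x y z by linarith [OrS1_reverse z x y, OrS1_rotate z x y],
    show OrS1 x w z = -OrS1 w x z by linarith [OrS1_reverse z w x, OrS1_rotate z w x],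
    show OrS1 y w z = -OrS1 w y z by linarith [OrS1_reverse z w y, OrS1_rotate z w y],
    show OrS1 x y w = OrS1 w x y from OrS1_rotate w x y,
    show OrS1 z w x = OrS1 w x z from (OrS1_rotate z w x).symm,
    show OrS1 y w x = OrS1 w x y from (OrS1_rotate y w x).symm]
  rcases OrS1_cases x y z with h1 | h1 | h1 <;> rcases OrS1_cases w y z with h2 | h2 | h2 <;>
    rcases OrS1_cases w x z with h3 | h3 | h3 <;> rcases OrS1_cases w x y with h4 | h4 | h4 <;>
    rw [h1, h2, h3, h4] at hc ⊢ <;> first | (exfalso; linarith) | norm_num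

theorem exists_perm_apply {i j k : Fin 7} (hij : i ≠ j) (hik : i ≠ k) (hjk : j ≠ k) :
    ∃ ρ : Equiv.Perm (Fin 7), ρ 0 = i ∧ ρ 1 = j ∧ ρ 2 = k := by
  have hinj : Function.Injective ![i, j, k] := by
    intro p q
    fin_cases p <;> fin_cases q <;> simp [hij, hik, hjk, hij.symm, hik.symm, hjk.symm]
  obtain ⟨ρ, h⟩ := Equiv.Perm.exists_extending_pair ![0, 1, 2] ![i, j, k] (by decide) hinj
  exact ⟨ρ, h 0, h 1, h 2⟩

theorem sum_perm_mul_right (F : Equiv.Perm (Fin 7) → ℝ) (ρ : Equiv.Perm (Fin 7)) :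
    ∑ σ, F (σ * ρ) = ∑ σ, F σ :=
  Equiv.sum_comp (Equiv.mulRight ρ) F

/-- Every ordered triple of distinct indices is the image of `(0, 1, 2)` under equally many
permutations. -/
theorem sum_perm_three_points_le (h : Fin 7 → Fin 7 → Fin 7 → ℝ) (hh : ∀ i j k, 0 ≤ h i j k) :
    210 * ∑ σ : Equiv.Perm (Fin 7), h (σ 0) (σ 1) (σ 2) ≤ 5040 * ∑ i, ∑ j, ∑ k, h i j k := by
  set N := ∑ σ : Equiv.Perm (Fin 7), h (σ 0) (σ 1) (σ 2) with hN
  have key (i j k : Fin 7) : ((if i ≠ j ∧ i ≠ k ∧ j ≠ k then 1 else 0 : ℕ) : ℝ) * N ≤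
      ∑ σ : Equiv.Perm (Fin 7), h (σ i) (σ j) (σ k) := by
    split_ifs with hd
    · obtain ⟨ρ, rfl, rfl, rfl⟩ := exists_perm_apply hd.1 hd.2.1 hd.2.2
      rw [hN, ← sum_perm_mul_right _ ρ]
      simp
    · simpa using Finset.sum_nonneg fun σ _ => hh _ _ _
  have hcount : ∑ i : Fin 7, ∑ j : Fin 7, ∑ k : Fin 7,
      (if i ≠ j ∧ i ≠ k ∧ j ≠ k then 1 else 0 : ℕ) = 210 := by rfl
  calc 210 * N = ∑ i : Fin 7, ∑ j : Fin 7, ∑ k : Fin 7,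
      ((if i ≠ j ∧ i ≠ k ∧ j ≠ k then 1 else 0 : ℕ) : ℝ) * N := by
        simp only [← Finset.sum_mul]
        rw [show (210 : ℝ) = ((210 : ℕ) : ℝ) by norm_num, ← hcount]
        push_cast
        rfl
    _ ≤ ∑ i, ∑ j, ∑ k, ∑ σ : Equiv.Perm (Fin 7), h (σ i) (σ j) (σ k) := by
        gcongr with i _ j _ k _
        exact key i j k
    _ = ∑ σ : Equiv.Perm (Fin 7), ∑ i, ∑ j, ∑ k, h (σ i) (σ j) (σ k) := by
        simp only [Finset.sum_comm (t := (Finset.univ : Finset (Equiv.Perm (Fin 7))))]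
    _ = ∑ _σ : Equiv.Perm (Fin 7), ∑ i, ∑ j, ∑ k, h i j k := by
        refine Finset.sum_congr rfl fun σ _ => ?_
        refine .trans ?_ (Equiv.sum_comp σ fun i => ∑ j, ∑ k, h i j k)
        refine Finset.sum_congr rfl fun i _ => ?_
        refine .trans ?_ (Equiv.sum_comp σ fun j => ∑ k, h (σ i) j k)
        exact Finset.sum_congr rfl fun j _ => Equiv.sum_comp σ fun k => h (σ i) (σ j) k
    _ = 5040 * ∑ i, ∑ j, ∑ k, h i j k := by
        rw [Finset.sum_const, Finset.card_univ, Fintype.card_perm, Fintype.card_fin, nsmul_eq_mul]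
        norm_num [Nat.factorial]

/-- The alternating sum defining `Theta` is at most two thirds of the total mass of its first factor,
by averaging over permutations of the last four points. -/
theorem abs_sum_perm_OrS1_le (x y z : Fin 7 → S1) :
    |∑ σ : Equiv.Perm (Fin 7), ((Equiv.Perm.sign σ : ℤ) : ℝ) *
      (OrS1 (x (σ 0)) (x (σ 1)) (x (σ 2)) * OrS1 (y (σ 2)) (y (σ 3)) (y (σ 4)) *
        OrS1 (z (σ 4)) (z (σ 5)) (z (σ 6)))| ≤
    2 / 3 * ∑ σ : Equiv.Perm (Fin 7), |OrS1 (x (σ 0)) (x (σ 1)) (x (σ 2))| := by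
  set F : Equiv.Perm (Fin 7) → ℝ := fun σ => ((Equiv.Perm.sign σ : ℤ) : ℝ) *
      (OrS1 (x (σ 0)) (x (σ 1)) (x (σ 2)) * OrS1 (y (σ 2)) (y (σ 3)) (y (σ 4)) *
        OrS1 (z (σ 4)) (z (σ 5)) (z (σ 6))) with hF
  set K : Equiv.Perm (Fin 7) → ℝ := fun σ => |OrS1 (x (σ 0)) (x (σ 1)) (x (σ 2))| *
    |OrS1 (z (σ 4)) (z (σ 5)) (z (σ 6)) + OrS1 (z (σ 3)) (z (σ 5)) (z (σ 6))| with hK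
  have sign_abs (σ : Equiv.Perm (Fin 7)) : |((Equiv.Perm.sign σ : ℤ) : ℝ)| = 1 := by
    rcases Int.units_eq_one_or (Equiv.Perm.sign σ) with h | h <;> simp [h]
  have h1 : 2 * |∑ σ, F σ| ≤ ∑ σ, K σ := by
    have : 2 * ∑ σ, F σ = ∑ σ, (F σ + F (σ * Equiv.swap 3 4)) := by
      rw [Finset.sum_add_distrib, sum_perm_mul_right F]; ring
    rw [← abs_of_pos (two_pos (α := ℝ)), ← abs_mul, this]
    refine (Finset.abs_sum_le_sum_abs _ _).trans (Finset.sum_le_sum fun σ _ => ?_)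
    have hs : ((Equiv.Perm.sign (σ * Equiv.swap 3 4) : ℤ) : ℝ) =
        -((Equiv.Perm.sign σ : ℤ) : ℝ) := by
      rw [Equiv.Perm.sign_mul, Equiv.Perm.sign_swap (by decide)]; simp
    have hy : OrS1 (y (σ 2)) (y (σ 4)) (y (σ 3)) = -OrS1 (y (σ 2)) (y (σ 3)) (y (σ 4)) := by
      rw [← OrS1_reverse, ← OrS1_rotate, ← OrS1_rotate]
    have e : F σ + F (σ * Equiv.swap 3 4) = ((Equiv.Perm.sign σ : ℤ) : ℝ) *
        OrS1 (x (σ 0)) (x (σ 1)) (x (σ 2)) * OrS1 (y (σ 2)) (y (σ 3)) (y (σ 4)) *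
        (OrS1 (z (σ 4)) (z (σ 5)) (z (σ 6)) + OrS1 (z (σ 3)) (z (σ 5)) (z (σ 6))) := by
      simp only [hF, hs]
      simp only [Equiv.Perm.mul_apply, Equiv.swap_apply_def, Fin.reduceEq, if_true, if_false, hy]
      ring
    rw [e, abs_mul, abs_mul, abs_mul, sign_abs, one_mul]
    exact mul_le_mul_of_nonneg_right
      (mul_le_of_le_one_right (abs_nonneg _) (abs_OrS1_le_one _ _ _)) (abs_nonneg _)
  have h2 : 6 * ∑ σ, K σ ≤ ∑ σ : Equiv.Perm (Fin 7),
      |OrS1 (x (σ 0)) (x (σ 1)) (x (σ 2))| * 8 := by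
    have : 6 * ∑ σ, K σ = ∑ σ, (K σ + K (σ * Equiv.swap 4 5) + K (σ * Equiv.swap 4 6) +
        K (σ * Equiv.swap 3 5) + K (σ * Equiv.swap 3 6) +
        K (σ * (Equiv.swap 3 5 * Equiv.swap 4 6))) := by
      simp only [Finset.sum_add_distrib, sum_perm_mul_right K]; ring
    rw [this]
    refine Finset.sum_le_sum fun σ _ => ?_
    simp only [hK, Equiv.Perm.mul_apply, Equiv.swap_apply_def, Fin.reduceEq, if_true, if_false]
    rw [← mul_add, ← mul_add, ← mul_add, ← mul_add, ← mul_add]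
    exact mul_le_mul_of_nonneg_left (sum_abs_OrS1_add_le _ _ _ _) (abs_nonneg _)
  rw [← Finset.sum_mul] at h2
  linarith

/-- If seven points on the circle take three values with multiplicities `3, 2, 2`, at most
`6 * 3 * 2 * 2` ordered triples have nonzero orientation. -/
theorem sum_abs_OrS1_le (x : Fin 7 → S1) (a b c : S1)
    (hab : a ≠ b) (hac : a ≠ c) (hbc : b ≠ c)
    (ha : {j : Fin 7 | x j = a}.ncard = 3) (hb : {j : Fin 7 | x j = b}.ncard = 2)
    (hc : {j : Fin 7 | x j = c}.ncard = 2) :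
    ∑ i, ∑ j, ∑ k, |OrS1 (x i) (x j) (x k)| ≤ 72 := by
  have hsum (t : S1) : ∑ j, (if x j = t then 1 else 0 : ℝ) = {j : Fin 7 | x j = t}.ncard := by
    rw [Set.ncard_eq_toFinset_card', Finset.sum_boole]
    congr 2
    ext; simp
  have hA := hsum a
  have hB := hsum b
  have hC := hsum c
  rw [ha] at hA; rw [hb] at hB; rw [hc] at hC
  set A : Fin 7 → ℝ := fun j => if x j = a then 1 else 0 with hAdef
  set B : Fin 7 → ℝ := fun j => if x j = b then 1 else 0 with hBdef
  set C : Fin 7 → ℝ := fun j => if x j = c then 1 else 0 with hCdef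
  have le_one (j : Fin 7) : A j + B j + C j ≤ 1 := by
    simp only [hAdef, hBdef, hCdef]
    split_ifs <;> grind
  have eq_one (j : Fin 7) : A j + B j + C j = 1 := by
    refine (Finset.sum_eq_sum_iff_of_le fun j _ => le_one j).1 ?_ j (Finset.mem_univ j)
    rw [Finset.sum_add_distrib, Finset.sum_add_distrib, hA, hB, hC]
    norm_num
  have cover (j : Fin 7) : x j = a ∨ x j = b ∨ x j = c := by
    by_contra! h
    simpa [hAdef, hBdef, hCdef, h] using eq_one j
  have bound (i j k : Fin 7) : |OrS1 (x i) (x j) (x k)| ≤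
      A i * B j * C k + A i * C j * B k + B i * A j * C k + B i * C j * A k +
      C i * A j * B k + C i * B j * A k := by
    have := abs_OrS1_le_one (x i) (x j) (x k)
    simp only [hAdef, hBdef, hCdef]
    rcases cover i with h1 | h1 | h1 <;> rcases cover j with h2 | h2 | h2 <;>
      rcases cover k with h3 | h3 | h3 <;> rw [h1, h2, h3] at this ⊢ <;>
      simp [OrS1_self_left, OrS1_self_right, OrS1_self_outer, hab, hac, hbc, hab.symm, hac.symm,
        hbc.symm, this]
  refine (Finset.sum_le_sum fun i _ => Finset.sum_le_sum fun j _ =>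
    Finset.sum_le_sum fun k _ => bound i j k).trans ?_
  simp only [Finset.sum_add_distrib, ← Finset.mul_sum, ← Finset.sum_mul, hA, hB, hC]
  norm_num

/-- If the seven first coordinates take exactly 3 distinct values with multiplicities
`3, 2, 2`, then `|Θ(θ₀,…,θ₆)| ≤ 8/35`. -/
theorem abs_Theta_le_of_mult_322 (θ : Fin 7 → T3) (a b c : S1)
    (hab : a ≠ b) (hac : a ≠ c) (hbc : b ≠ c)
    (ha : ({j : Fin 7 | (θ j).1 = a}).ncard = 3)
    (hb : ({j : Fin 7 | (θ j).1 = b}).ncard = 2)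
    (hc : ({j : Fin 7 | (θ j).1 = c}).ncard = 2) :
    |Theta θ| ≤ 8 / 35 := by
  have h1 := abs_sum_perm_OrS1_le (fun j => (θ j).1) (fun j => (θ j).2.1) (fun j => (θ j).2.2)
  have h2 := sum_perm_three_points_le (fun i j k => |OrS1 (θ i).1 (θ j).1 (θ k).1|)
    fun _ _ _ => abs_nonneg _
  have h3 := sum_abs_OrS1_le (fun j => (θ j).1) a b c hab hac hbc ha hb hc
  rw [Theta, abs_mul, show (Nat.factorial 7 : ℝ) = 5040 by norm_num [Nat.factorial],
    abs_of_pos (by norm_num : (0 : ℝ) < 1 / 5040)]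
  linarith
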